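/- Fix γ, ξ ∈ ℝ and let φ be a ground state of H[γ,ξ]. Then the function γ' ↦ μ⁽¹⁾(γ',ξ) is differentiable at γ' = γ, with derivative equal to |φ(0)|². -/

import Mathlib

open MeasureTheory Set Filter

/-- An admissible function on the half-line `[0,∞)`: `u` is continuous on `[0,∞)`,
locally absolutely continuous with derivative `u'` (expressed by the integral
representation), and `u`, `u'`, `t·u(t)` all belong to `L²((0,∞))`. -/
structure AdmissibleHL (u u' : ℝ → ℂ) : Prop where
  cont : ContinuousOn u (Ici 0)
  locInt : ∀ t ∈ Ici (0:ℝ), IntervalIntegrable u' volume 0 t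
  ac : ∀ t ∈ Ici (0:ℝ), u t = u 0 + ∫ s in (0:ℝ)..t, u' s
  memL2 : IntegrableOn (fun t => ‖u t‖ ^ 2) (Ioi 0)
  memL2' : IntegrableOn (fun t => ‖u' t‖ ^ 2) (Ioi 0)
  memL2t : IntegrableOn (fun t => t ^ 2 * ‖u t‖ ^ 2) (Ioi 0)

/-- The quadratic form `q[γ,ξ](u) = ∫₀^∞ (|u'|² + (t-ξ)²|u|²) dt + γ|u(0)|²`. -/
noncomputable def qform (γ ξ : ℝ) (u u' : ℝ → ℂ) : ℝ :=
  (∫ t in Ioi (0:ℝ), (‖u' t‖ ^ 2 + (t - ξ) ^ 2 * ‖u t‖ ^ 2)) + γ * ‖u 0‖ ^ 2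

/-- The ground state energy `μ⁽¹⁾(γ,ξ)`: the infimum of the Rayleigh quotients of
the quadratic form `q[γ,ξ]` over admissible functions not identically zero. -/
noncomputable def mu1 (γ ξ : ℝ) : ℝ :=
  sInf { r : ℝ | ∃ u u' : ℝ → ℂ, AdmissibleHL u u' ∧ (∃ t ∈ Ici (0:ℝ), u t ≠ 0) ∧
    r = qform γ ξ u u' / ∫ t in Ioi (0:ℝ), ‖u t‖ ^ 2 }

/-- `Θ(γ) = inf_{ξ ∈ ℝ} μ⁽¹⁾(γ,ξ)`. -/
noncomputable def Theta (γ : ℝ) : ℝ := ⨅ ξ : ℝ, mu1 γ ξ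

/-- A ground state of `H[γ,ξ]` with eigenvalue `μ`: a twice continuously differentiable
positive function on `[0,∞)`, `L²`-normalized, with `φ, φ', t²·φ(t) ∈ L²((0,∞))`,
satisfying `-φ'' + (t-ξ)²φ = μ·φ` on `[0,∞)` and the boundary condition `φ'(0) = γ·φ(0)`. -/
structure IsGroundState (γ ξ μ : ℝ) (φ φ' φ'' : ℝ → ℝ) : Prop where
  deriv1 : ∀ t ∈ Ici (0:ℝ), HasDerivWithinAt φ (φ' t) (Ici 0) t
  deriv2 : ∀ t ∈ Ici (0:ℝ), HasDerivWithinAt φ' (φ'' t) (Ici 0) t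
  cont2 : ContinuousOn φ'' (Ici 0)
  pos : ∀ t ∈ Ici (0:ℝ), 0 < φ t
  normalized : (∫ t in Ioi (0:ℝ), (φ t) ^ 2) = 1
  memL2 : IntegrableOn (fun t => (φ t) ^ 2) (Ioi 0)
  memL2' : IntegrableOn (fun t => (φ' t) ^ 2) (Ioi 0)
  memL2t : IntegrableOn (fun t => (t ^ 2 * φ t) ^ 2) (Ioi 0)
  eqn : ∀ t ∈ Ici (0:ℝ), -φ'' t + (t - ξ) ^ 2 * φ t = μ * φ t
  bc : φ' 0 = γ * φ 0

open Topology

/-- A function bounded below by a positive constant near infinity is not integrable. -/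
lemma false_of_integrableOn_Ioi_of_le {f : ℝ → ℝ} {a T δ : ℝ} (hf : IntegrableOn f (Ioi a))
    (hT : a ≤ T) (hδ : 0 < δ) (h : ∀ t, T < t → δ ≤ f t) : False := by
  have hf' : IntegrableOn f (Ioi T) := hf.mono_set (Ioi_subset_Ioi hT)
  have hc : IntegrableOn (fun _ : ℝ => δ) (Ioi T) := by
    refine Integrable.mono' hf' aestronglyMeasurable_const ?_
    refine (ae_restrict_mem measurableSet_Ioi).mono fun t ht => ?_
    rw [Real.norm_of_nonneg hδ.le]
    exact h t ht
  simp [integrableOn_const_iff, hδ.ne'] at hc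

/-- A Grönwall-type sign propagation: if `N' ≤ K' N` with `K' ≥ 0` and `N` is negative at `a`,
then `N` stays below `N a` on `[a, ∞)`. -/
lemma le_of_deriv_le_mul {N N' K K' : ℝ → ℝ} {a : ℝ}
    (hN : ∀ t ∈ Ici a, HasDerivWithinAt N (N' t) (Ici a) t)
    (hK : ∀ t, HasDerivAt K (K' t) t) (hK' : ∀ t ∈ Ici a, 0 ≤ K' t)
    (hle : ∀ t ∈ Ici a, N' t ≤ K' t * N t) (ha : N a < 0) :
    ∀ t ∈ Ici a, N t ≤ N a := by
  have hKmono : MonotoneOn K (Ici a) := by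
    refine monotoneOn_of_hasDerivWithinAt_nonneg (convex_Ici a) (f' := K')
      (fun t _ => (hK t).continuousAt.continuousWithinAt)
      (fun t _ => (hK t).hasDerivWithinAt) fun t ht => hK' t (interior_subset ht)
  have hder : ∀ t ∈ Ici a, HasDerivWithinAt (fun t => N t * Real.exp (-K t))
      (N' t * Real.exp (-K t) + N t * (Real.exp (-K t) * -K' t)) (Ici a) t := fun t ht =>
    (hN t ht).mul (hK t).neg.exp.hasDerivWithinAt
  have hanti : AntitoneOn (fun t => N t * Real.exp (-K t)) (Ici a) := by
    refine antitoneOn_of_hasDerivWithinAt_nonpos (convex_Ici a)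
      (fun t ht => (hder t ht).continuousWithinAt)
      (fun t ht => (hder t (interior_subset ht)).mono interior_subset) fun t ht => ?_
    have h1 := hle t (interior_subset ht)
    have h2 := Real.exp_pos (-K t)
    nlinarith
  intro t ht
  have h1 : N t * Real.exp (-K t) ≤ N a * Real.exp (-K a) := hanti self_mem_Ici ht ht
  have h2 : K a ≤ K t := hKmono self_mem_Ici ht ht
  have h3 : N t ≤ N a * Real.exp (K t - K a) := by
    have h4 := mul_le_mul_of_nonneg_right h1 (Real.exp_pos (K t)).le
    rw [mul_assoc, mul_assoc, ← Real.exp_add, ← Real.exp_add] at h4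
    simpa [add_comm, sub_eq_add_neg] using h4
  have h4 : 1 ≤ Real.exp (K t - K a) := Real.one_le_exp (by linarith)
  nlinarith

/-- Completing the square: for `x` absolutely continuous and `g` continuously differentiable,
the increment of `g x²` is at most the integral of `x'² + (g' + g²) x²`. -/
lemma mul_sq_sub_le_integral {x x' g g' : ℝ → ℝ} {T : ℝ} (hT : 0 ≤ T)
    (hx' : IntervalIntegrable x' volume 0 T)
    (hx'2 : IntervalIntegrable (fun t => x' t ^ 2) volume 0 T)
    (hx : ∀ t ∈ Icc 0 T, x t = x 0 + ∫ s in (0:ℝ)..t, x' s)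
    (hg : ∀ t ∈ Icc 0 T, HasDerivWithinAt g (g' t) (Icc 0 T) t)
    (hg' : ContinuousOn g' (Icc 0 T)) :
    g T * x T ^ 2 - g 0 * x 0 ^ 2 ≤
      ∫ t in (0:ℝ)..T, (x' t ^ 2 + (g' t + g t ^ 2) * x t ^ 2) := by
  have hu : uIcc 0 T = Icc 0 T := uIcc_of_le hT
  set X : ℝ → ℝ := fun t => x 0 + ∫ s in (0:ℝ)..t, x' s with hX
  have hXac : AbsolutelyContinuousOnInterval X 0 T := by
    have hc : AbsolutelyContinuousOnInterval (fun _ : ℝ => x 0) 0 T :=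
      ((LipschitzWith.const (x 0)).lipschitzOnWith (s := uIcc 0 T)).absolutelyContinuousOnInterval
    exact hc.add (hx'.absolutelyContinuousOnInterval_intervalIntegral (by simp [hT]))
  have hgac : AbsolutelyContinuousOnInterval g 0 T := by
    obtain ⟨M, hM⟩ := isCompact_Icc.exists_bound_of_continuousOn hg'
    refine LipschitzOnWith.absolutelyContinuousOnInterval (K := M.toNNReal) ?_
    rw [hu]
    refine (convex_Icc 0 T).lipschitzOnWith_of_nnnorm_hasDerivWithin_le hg fun t ht => ?_
    rw [← NNReal.coe_le_coe, coe_nnnorm]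
    exact (hM t ht).trans (Real.le_coe_toNNReal M)
  have hgc : ContinuousOn g (Icc 0 T) := fun t ht => (hg t ht).continuousWithinAt
  have hac := hgac.fun_mul (hXac.fun_mul hXac)
  have hXc : ContinuousOn X (Icc 0 T) := hu ▸ hXac.continuousOn
  have hxc : ContinuousOn x (Icc 0 T) := hXc.congr hx
  have hFTC := hac.integral_deriv_eq_sub
  have hend : ∀ t ∈ Icc 0 T, X t = x t := fun t ht => (hx t ht).symm
  rw [hend T ⟨hT, le_rfl⟩, hend 0 ⟨le_rfl, hT⟩] at hFTC
  have hde : ∀ᵐ t, t ∈ Icc 0 T →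
      deriv (fun t => g t * (X t * X t)) t ≤ x' t ^ 2 + (g' t + g t ^ 2) * x t ^ 2 := by
    have h0 : ∀ᵐ t : ℝ, t ≠ 0 := by simp [ae_iff, measure_singleton]
    have h1 : ∀ᵐ t : ℝ, t ≠ T := by simp [ae_iff, measure_singleton]
    filter_upwards [hx'.ae_hasDerivAt_integral, h0, h1] with t ht ht0 htT htm
    have hXd : HasDerivAt X (x' t) t := by
      exact (ht (hu ▸ htm) 0 (by simp [hT])).const_add (x 0)
    have hgd : HasDerivAt g (g' t) t := (hg t htm).hasDerivAt
      (Icc_mem_nhds (lt_of_le_of_ne htm.1 (Ne.symm ht0)) (lt_of_le_of_ne htm.2 htT))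
    rw [(hgd.fun_mul (hXd.fun_mul hXd)).deriv, hend t htm]
    nlinarith [sq_nonneg (x' t - g t * x t)]
  have hint : IntervalIntegrable (fun t => x' t ^ 2 + (g' t + g t ^ 2) * x t ^ 2) volume 0 T := by
    refine hx'2.add (ContinuousOn.intervalIntegrable ?_)
    rw [hu]
    exact (hg'.add (hgc.pow 2)).mul (hxc.pow 2)
  have hle := intervalIntegral.integral_mono_ae_restrict hT hac.intervalIntegrable_deriv hint
    ((ae_restrict_iff' measurableSet_Icc).2 hde)
  rw [hFTC] at hle
  linarith [hle]

namespace AdmissibleHL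

variable {u u' : ℝ → ℂ}

lemma integrableOn_potential (hu : AdmissibleHL u u') (ξ : ℝ) :
    IntegrableOn (fun t => (t - ξ) ^ 2 * ‖u t‖ ^ 2) (Ioi 0) := by
  refine Integrable.mono' ((hu.memL2t.const_mul 2).add (hu.memL2.const_mul (2 * ξ ^ 2))) ?_ ?_
  · refine ContinuousOn.aestronglyMeasurable ?_ measurableSet_Ioi
    have := hu.cont.mono Ioi_subset_Ici_self
    fun_prop
  · refine Eventually.of_forall fun t => ?_
    rw [Real.norm_of_nonneg (by positivity)]
    simp only [Pi.add_apply]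
    nlinarith [mul_nonneg (sq_nonneg (t + ξ)) (sq_nonneg ‖u t‖)]

lemma integral_norm_sq_pos (hu : AdmissibleHL u u') (hne : ∃ t ∈ Ici (0:ℝ), u t ≠ 0) :
    0 < ∫ t in Ioi (0:ℝ), ‖u t‖ ^ 2 := by
  obtain ⟨t₀, ht₀, hne⟩ := hne
  have hnn : 0 ≤ᵐ[volume.restrict (Ioi (0:ℝ))] fun t => ‖u t‖ ^ 2 :=
    Eventually.of_forall fun t => by positivity
  rw [setIntegral_pos_iff_support_of_nonneg_ae hnn hu.memL2]
  have hev : ∀ᶠ t in 𝓝[≥] t₀, u t ≠ 0 :=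
    ((hu.cont t₀ ht₀).mono (Ici_subset_Ici.2 ht₀)).eventually_ne hne
  obtain ⟨b, hb, hsub⟩ := mem_nhdsGE_iff_exists_Ico_subset.1 hev
  refine lt_of_lt_of_le ?_ (measure_mono (s := Ioo t₀ b) fun t ht => ⟨?_, ?_⟩)
  · simpa using hb
  · have : u t ≠ 0 := hsub ⟨ht.1.le, ht.2⟩
    simpa using this
  · exact lt_of_le_of_lt ht₀ ht.1

lemma re_im_intervalIntegrable_sq (hu : AdmissibleHL u u') {T : ℝ} (hT : 0 ≤ T) :
    IntervalIntegrable (fun t => (u' t).re ^ 2) volume 0 T ∧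
    IntervalIntegrable (fun t => (u' t).im ^ 2) volume 0 T := by
  have hL : IntegrableOn (fun t => ‖u' t‖ ^ 2) (Ioc 0 T) := hu.memL2'.mono_set Ioc_subset_Ioi_self
  have hm := ((intervalIntegrable_iff_integrableOn_Ioc_of_le hT).1
    (hu.locInt T hT)).aestronglyMeasurable
  rw [intervalIntegrable_iff_integrableOn_Ioc_of_le hT,
    intervalIntegrable_iff_integrableOn_Ioc_of_le hT]
  constructor
  · refine Integrable.mono' hL ((Complex.continuous_re.comp_aestronglyMeasurable hm).pow 2)
      (Eventually.of_forall fun t => ?_)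
    rw [Real.norm_of_nonneg (by positivity), Complex.sq_norm, Complex.normSq_apply]
    nlinarith [sq_nonneg (u' t).im]
  · refine Integrable.mono' hL ((Complex.continuous_im.comp_aestronglyMeasurable hm).pow 2)
      (Eventually.of_forall fun t => ?_)
    rw [Real.norm_of_nonneg (by positivity), Complex.sq_norm, Complex.normSq_apply]
    nlinarith [sq_nonneg (u' t).re]

lemma mul_norm_sq_sub_le_integral (hu : AdmissibleHL u u') {g g' : ℝ → ℝ}
    (hg : ∀ t ∈ Ici (0:ℝ), HasDerivWithinAt g (g' t) (Ici 0) t)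
    (hg' : ContinuousOn g' (Ici 0)) {T : ℝ} (hT : 0 ≤ T) :
    g T * ‖u T‖ ^ 2 - g 0 * ‖u 0‖ ^ 2 ≤
      ∫ t in (0:ℝ)..T, (‖u' t‖ ^ 2 + (g' t + g t ^ 2) * ‖u t‖ ^ 2) := by
  have hgT : ∀ t ∈ Icc 0 T, HasDerivWithinAt g (g' t) (Icc 0 T) t := fun t ht =>
    (hg t ht.1).mono Icc_subset_Ici_self
  have hgT' : ContinuousOn g' (Icc 0 T) := hg'.mono Icc_subset_Ici_self
  have hgc : ContinuousOn g (Icc 0 T) := fun t ht => (hgT t ht).continuousWithinAt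
  have huc : ContinuousOn u (Icc 0 T) := hu.cont.mono Icc_subset_Ici_self
  have hloc := hu.locInt T hT
  have hsub : ∀ t ∈ Icc 0 T, IntervalIntegrable u' volume 0 t := fun t ht => hu.locInt t ht.1
  obtain ⟨hre2, him2⟩ := hu.re_im_intervalIntegrable_sq hT
  have hre : IntervalIntegrable (fun t => (u' t).re) volume 0 T := ⟨hloc.1.re, hloc.2.re⟩
  have him : IntervalIntegrable (fun t => (u' t).im) volume 0 T := ⟨hloc.1.im, hloc.2.im⟩
  have h1 := mul_sq_sub_le_integral (x := fun t => (u t).re) hT hre hre2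
    (fun t ht => by
      have := Complex.reCLM.intervalIntegral_comp_comm (hsub t ht)
      simp only [Complex.reCLM_apply] at this
      rw [this, ← Complex.add_re, ← hu.ac t ht.1]) hgT hgT'
  have h2 := mul_sq_sub_le_integral (x := fun t => (u t).im) hT him him2
    (fun t ht => by
      have := Complex.imCLM.intervalIntegral_comp_comm (hsub t ht)
      simp only [Complex.imCLM_apply] at this
      rw [this, ← Complex.add_im, ← hu.ac t ht.1]) hgT hgT'
  have hc1 : IntervalIntegrable (fun t => (g' t + g t ^ 2) * (u t).re ^ 2) volume 0 T := by
    refine ContinuousOn.intervalIntegrable ?_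
    rw [uIcc_of_le hT]
    have := Complex.continuous_re.comp_continuousOn huc
    exact (hgT'.add (hgc.pow 2)).mul (this.pow 2)
  have hc2 : IntervalIntegrable (fun t => (g' t + g t ^ 2) * (u t).im ^ 2) volume 0 T := by
    refine ContinuousOn.intervalIntegrable ?_
    rw [uIcc_of_le hT]
    have := Complex.continuous_im.comp_continuousOn huc
    exact (hgT'.add (hgc.pow 2)).mul (this.pow 2)
  have h3 := intervalIntegral.integral_add (hre2.add hc1) (him2.add hc2)
  have h4 : (∫ t in (0:ℝ)..T, (‖u' t‖ ^ 2 + (g' t + g t ^ 2) * ‖u t‖ ^ 2)) =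
      (∫ t in (0:ℝ)..T, ((u' t).re ^ 2 + (g' t + g t ^ 2) * (u t).re ^ 2)) +
      ∫ t in (0:ℝ)..T, ((u' t).im ^ 2 + (g' t + g t ^ 2) * (u t).im ^ 2) := by
    rw [← h3]
    refine intervalIntegral.integral_congr fun t _ => ?_
    simp only [Complex.sq_norm, Complex.normSq_apply]
    ring
  rw [h4]
  simp only [Complex.sq_norm, Complex.normSq_apply]
  linarith

/-- A subsolution `g` of the Riccati equation with at most linear decay gives a lower bound for
the quadratic form. -/
lemma mul_integral_le_qform (hu : AdmissibleHL u u') {γ ξ E C : ℝ} {g g' : ℝ → ℝ}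
    (hg : ∀ t ∈ Ici (0:ℝ), HasDerivWithinAt g (g' t) (Ici 0) t)
    (hg' : ContinuousOn g' (Ici 0))
    (hric : ∀ t ∈ Ici (0:ℝ), g' t + g t ^ 2 ≤ (t - ξ) ^ 2 - E)
    (hg0 : g 0 ≤ γ) (hlow : ∀ t ∈ Ici (0:ℝ), -(C * (1 + t)) ≤ g t) :
    E * ∫ t in Ioi (0:ℝ), ‖u t‖ ^ 2 ≤ qform γ ξ u u' := by
  have hI : IntegrableOn (fun t => ‖u' t‖ ^ 2 + (t - ξ) ^ 2 * ‖u t‖ ^ 2) (Ioi 0) :=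
    hu.memL2'.add (hu.integrableOn_potential ξ)
  have hD : IntegrableOn (fun t => (‖u' t‖ ^ 2 + (t - ξ) ^ 2 * ‖u t‖ ^ 2) - E * ‖u t‖ ^ 2)
      (Ioi 0) := hI.sub (hu.memL2.const_mul E)
  have hDint := integral_sub hI (hu.memL2.const_mul E)
  rw [integral_const_mul] at hDint
  have hgc : ContinuousOn g (Ici 0) := fun t ht => (hg t ht).continuousWithinAt
  have hT : ∀ T ∈ Ici (0:ℝ), g T * ‖u T‖ ^ 2 - g 0 * ‖u 0‖ ^ 2 ≤
      ∫ t in (0:ℝ)..T, ((‖u' t‖ ^ 2 + (t - ξ) ^ 2 * ‖u t‖ ^ 2) - E * ‖u t‖ ^ 2) := by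
    intro T hT
    refine (hu.mul_norm_sq_sub_le_integral hg hg' hT).trans ?_
    refine intervalIntegral.integral_mono_on hT ?_ ?_ fun t ht => ?_
    · refine IntervalIntegrable.add ?_ (ContinuousOn.intervalIntegrable ?_)
      · exact (intervalIntegrable_iff_integrableOn_Ioc_of_le hT).2
          (hu.memL2'.mono_set Ioc_subset_Ioi_self)
      · rw [uIcc_of_le hT]
        exact ((hg'.add (hgc.pow 2)).mul (hu.cont.norm.pow 2)).mono Icc_subset_Ici_self
    · exact (intervalIntegrable_iff_integrableOn_Ioc_of_le hT).2 (hD.mono_set Ioc_subset_Ioi_self)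
    · nlinarith [hric t ht.1, sq_nonneg ‖u t‖]
  by_contra! hcon
  unfold qform at hcon
  set J := ∫ t in Ioi (0:ℝ), (‖u' t‖ ^ 2 + (t - ξ) ^ 2 * ‖u t‖ ^ 2)
  set n := ∫ t in Ioi (0:ℝ), ‖u t‖ ^ 2
  have hδ : 0 < (E * n - J - γ * ‖u 0‖ ^ 2) / 2 := by linarith
  have hlim := intervalIntegral_tendsto_integral_Ioi 0 hD tendsto_id
  rw [hDint] at hlim
  have hev := (hlim.eventually (gt_mem_nhds (show J - E * n <
    J - E * n + (E * n - J - γ * ‖u 0‖ ^ 2) / 2 by linarith))).and (eventually_ge_atTop 0)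
  obtain ⟨T, hTge⟩ := eventually_atTop.1 hev
  refine false_of_integrableOn_Ioi_of_le (T := T)
    (((hu.memL2.const_mul 2).add (hu.memL2t.const_mul 2)).const_mul |C|)
    (hTge T le_rfl).2 hδ fun t ht => ?_
  obtain ⟨h1, h2⟩ := hTge t ht.le
  have h3 := hT t h2
  simp only [id] at h1
  have h4 : -(|C| * (2 + 2 * t ^ 2)) ≤ g t := by
    refine le_trans ?_ (hlow t h2)
    have : C * (1 + t) ≤ |C| * (2 + 2 * t ^ 2) :=
      mul_le_mul (le_abs_self C) (by nlinarith [sq_nonneg (t - 1)]) (by linarith) (abs_nonneg C)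
    linarith
  have h5 : g 0 * ‖u 0‖ ^ 2 ≤ γ * ‖u 0‖ ^ 2 := by gcongr
  have h6 := mul_le_mul_of_nonneg_right h4 (sq_nonneg ‖u t‖)
  simp only [Pi.add_apply]
  linarith

end AdmissibleHL

namespace IsGroundState

variable {γ ξ μ : ℝ} {φ φ' φ'' : ℝ → ℝ}

lemma continuousOn (h : IsGroundState γ ξ μ φ φ' φ'') : ContinuousOn φ (Ici 0) :=
  fun t ht => (h.deriv1 t ht).continuousWithinAt

lemma continuousOn_deriv (h : IsGroundState γ ξ μ φ φ' φ'') : ContinuousOn φ' (Ici 0) :=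
  fun t ht => (h.deriv2 t ht).continuousWithinAt

lemma deriv_le_neg (h : IsGroundState γ ξ μ φ φ' φ'') :
    ∀ t ∈ Ici (|ξ| + |μ| + 1), φ' t ≤ -φ t := by
  intro t₀ ht₀
  have hR : 0 ≤ |ξ| + |μ| + 1 := by positivity
  have ht₀0 : 0 ≤ t₀ := hR.trans ht₀
  by_contra! hcon
  have hsub : Ici t₀ ⊆ Ici 0 := Ici_subset_Ici.2 ht₀0
  have key := le_of_deriv_le_mul (N := fun t => -(φ t + φ' t)) (N' := fun t => -(φ' t + φ'' t))
    (K := fun t => t) (K' := fun _ => 1) (a := t₀)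
    (fun t ht => (((h.deriv1 t (hsub ht)).add (h.deriv2 t (hsub ht))).neg).mono hsub)
    (fun t => hasDerivAt_id t) (fun _ _ => zero_le_one)
    (fun t ht => by
      have h1 := h.eqn t (hsub ht)
      have h2 := h.pos t (hsub ht)
      have h3 : 1 ≤ (t - ξ) ^ 2 - μ := by
        have h4 : |μ| + 1 ≤ t - ξ := by
          have : t₀ ≤ t := ht
          have : |ξ| + |μ| + 1 ≤ t₀ := ht₀
          linarith [le_abs_self ξ]
        nlinarith [le_abs_self μ, abs_nonneg μ]
      nlinarith) (by linarith)
  refine false_of_integrableOn_Ioi_of_le (T := t₀) (δ := (φ t₀ + φ' t₀) ^ 2)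
    ((h.memL2.const_mul 2).add (h.memL2'.const_mul 2)) ht₀0 (pow_pos (by linarith) 2)
    fun t ht => ?_
  have h1 := key t ht.le
  simp only [Pi.add_apply]
  nlinarith [sq_nonneg (φ t - φ' t)]

lemma neg_mul_le_deriv (h : IsGroundState γ ξ μ φ φ' φ'') :
    ∀ t ∈ Ici (0:ℝ), -((t + (|ξ| + |μ| + 1)) * φ t) ≤ φ' t := by
  intro t₀ ht₀
  by_contra! hcon
  set c := |ξ| + |μ| + 1 with hc
  have hc0 : 0 ≤ c := by positivity
  have hsub : Ici t₀ ⊆ Ici 0 := Ici_subset_Ici.2 ht₀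
  have key := le_of_deriv_le_mul (N := fun t => φ' t + (t + c) * φ t)
    (N' := fun t => φ'' t + (1 * φ t + (t + c) * φ' t))
    (K := fun t => (t + c) ^ 2 / 2) (K' := fun t => t + c) (a := t₀)
    (fun t ht => ((h.deriv2 t (hsub ht)).add
      (((hasDerivAt_id t).add_const c).hasDerivWithinAt.mul (h.deriv1 t (hsub ht)))).mono hsub)
    (fun t => by
      have := (((hasDerivAt_id t).add_const c).pow 2).div_const 2
      refine this.congr_deriv ?_
      simp)
    (fun t ht => add_nonneg (hsub ht) hc0)
    (fun t ht => by
      have ht0 : 0 ≤ t := hsub ht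
      have h1 := h.eqn t ht0
      have h2 := h.pos t ht0
      have h3 : (t - ξ) ^ 2 - μ + 1 ≤ (t + c) ^ 2 := by
        have h4 : -ξ ≤ |ξ| := neg_le_abs ξ
        have h5 : 0 ≤ t * (c + ξ) := mul_nonneg ht0 (by linarith [abs_nonneg μ])
        have h6 : ξ ^ 2 - μ + 1 ≤ c ^ 2 := by
          rw [← sq_abs ξ, hc]
          nlinarith [abs_nonneg ξ, abs_nonneg μ, neg_abs_le μ,
            mul_nonneg (abs_nonneg ξ) (abs_nonneg μ)]
        nlinarith
      have h7 := mul_le_mul_of_nonneg_right h3 h2.le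
      linarith) (by linarith)
  refine false_of_integrableOn_Ioi_of_le (T := t₀) (δ := (φ' t₀ + (t₀ + c) * φ t₀) ^ 2)
    h.memL2' ht₀ (sq_pos_of_neg (by linarith)) fun t ht => ?_
  have h1 := key t ht.le
  have ht0 : 0 ≤ t := hsub ht.le
  have h2 := mul_nonneg (add_nonneg ht0 hc0) (h.pos t ht0).le
  nlinarith

/-- The tail mass `F t = ∫ₜ^∞ φ²` of a ground state is controlled by `φ²`. -/
lemma exists_tail (h : IsGroundState γ ξ μ φ φ' φ'') :
    ∃ (F : ℝ → ℝ) (M : ℝ), F 0 = 1 ∧ (∀ t ∈ Ici (0:ℝ), 0 ≤ F t) ∧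
      (∀ t ∈ Ici (0:ℝ), HasDerivWithinAt F (-φ t ^ 2) (Ici 0) t) ∧
      ∀ t ∈ Ici (0:ℝ), F t ≤ M * φ t ^ 2 := by
  set ψ : ℝ → ℝ := fun t => φ (max t 0) with hψ
  have hψc : Continuous ψ := h.continuousOn.comp_continuous (by fun_prop) fun t => le_max_right t 0
  have hψe : ∀ t ∈ Ici (0:ℝ), ψ t = φ t := fun t ht => by simp [hψ, max_eq_left (mem_Ici.1 ht)]
  set F : ℝ → ℝ := fun t => 1 - ∫ s in (0:ℝ)..t, ψ s ^ 2 with hF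
  have hFd : ∀ t ∈ Ici (0:ℝ), HasDerivWithinAt F (-φ t ^ 2) (Ici 0) t := fun t ht => by
    rw [← hψe t ht]
    exact ((hψc.pow 2).integral_hasStrictDerivAt 0 t).hasDerivAt.const_sub 1 |>.hasDerivWithinAt
  have hFlim : Tendsto F atTop (𝓝 0) := by
    have hi : IntegrableOn (fun t => ψ t ^ 2) (Ioi 0) :=
      h.memL2.congr_fun (fun t ht => by simp only [hψe t (Ioi_subset_Ici_self ht)])
        measurableSet_Ioi
    have hv : ∫ t in Ioi (0:ℝ), ψ t ^ 2 = 1 := by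
      rw [← h.normalized]
      exact setIntegral_congr_fun measurableSet_Ioi
        (fun t ht => by simp only [hψe t (Ioi_subset_Ici_self ht)])
    have := intervalIntegral_tendsto_integral_Ioi 0 hi tendsto_id
    rw [hv] at this
    simpa using this.const_sub 1
  have hFc : ContinuousOn F (Ici 0) := fun t ht => (hFd t ht).continuousWithinAt
  have hFanti : AntitoneOn F (Ici 0) :=
    antitoneOn_of_hasDerivWithinAt_nonpos (convex_Ici 0) hFc
      (fun t ht => (hFd t (interior_subset ht)).mono interior_subset)
      fun t _ => by nlinarith [sq_nonneg (φ t)]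
  have hF0 : ∀ t ∈ Ici (0:ℝ), 0 ≤ F t := fun t ht => by
    refine le_of_tendsto hFlim ?_
    filter_upwards [eventually_ge_atTop t] with s hs
    exact hFanti ht (le_trans ht hs) hs
  set R := |ξ| + |μ| + 1
  have hR : 0 ≤ R := by positivity
  have hsub : Ici R ⊆ Ici 0 := Ici_subset_Ici.2 hR
  have hGd : ∀ t ∈ Ici R, HasDerivWithinAt (fun t => φ t ^ 2 - 2 * F t)
      (2 * φ t ^ (2 - 1) * φ' t - 2 * -φ t ^ 2) (Ici R) t := fun t ht =>
    (((h.deriv1 t (hsub ht)).fun_pow 2).sub ((hFd t (hsub ht)).const_mul 2)).mono hsub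
  have hGanti : AntitoneOn (fun t => φ t ^ 2 - 2 * F t) (Ici R) :=
    antitoneOn_of_hasDerivWithinAt_nonpos (convex_Ici R)
      (fun t ht => (hGd t ht).continuousWithinAt)
      (fun t ht => (hGd t (interior_subset ht)).mono interior_subset)
      fun t ht => by
        have h1 := h.deriv_le_neg t (interior_subset ht)
        have h2 := h.pos t (hsub (interior_subset ht))
        simp only [Nat.add_one_sub_one, pow_one]
        nlinarith
  have hfar : ∀ t ∈ Ici R, F t ≤ φ t ^ 2 := fun t ht => by
    have h1 : -2 * 0 ≤ φ t ^ 2 - 2 * F t := by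
      refine le_of_tendsto (hFlim.const_mul (-2)) ?_
      filter_upwards [eventually_ge_atTop t] with s hs
      have := hGanti ht (le_trans ht hs) hs
      simp only at this
      nlinarith [sq_nonneg (φ s)]
    have h2 := hF0 t (hsub ht)
    linarith
  have hcq : ContinuousOn (fun t => F t / φ t ^ 2) (Icc 0 R) :=
    ((hFc.div (h.continuousOn.pow 2)) fun t ht => (pow_pos (h.pos t ht) 2).ne').mono
      Icc_subset_Ici_self
  obtain ⟨M, hM⟩ := isCompact_Icc.exists_bound_of_continuousOn hcq
  refine ⟨F, max M 1, by simp [hF], hF0, hFd, fun t ht => ?_⟩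
  have hp := pow_pos (h.pos t ht) 2
  rcases le_total t R with htR | htR
  · have h1 := (le_abs_self _).trans (hM t ⟨ht, htR⟩)
    rw [div_le_iff₀ hp] at h1
    exact h1.trans (by gcongr; exact le_max_left _ _)
  · have h1 := hfar t htR
    nlinarith [le_max_right M 1]

lemma admissibleHL (h : IsGroundState γ ξ μ φ φ' φ'') :
    AdmissibleHL (fun t => (φ t : ℂ)) (fun t => (φ' t : ℂ)) where
  cont := Complex.continuous_ofReal.comp_continuousOn h.continuousOn
  locInt t ht := by
    refine ContinuousOn.intervalIntegrable ?_
    rw [uIcc_of_le ht]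
    exact (Complex.continuous_ofReal.comp_continuousOn h.continuousOn_deriv).mono
      Icc_subset_Ici_self
  ac t ht := by
    have h1 : ∫ s in (0:ℝ)..t, φ' s = φ t - φ 0 := by
      refine intervalIntegral.integral_eq_sub_of_hasDerivAt_of_le ht
        (h.continuousOn.mono Icc_subset_Ici_self)
        (fun s hs => (h.deriv1 s hs.1.le).hasDerivAt (Ici_mem_nhds hs.1)) ?_
      refine ContinuousOn.intervalIntegrable ?_
      rw [uIcc_of_le ht]
      exact h.continuousOn_deriv.mono Icc_subset_Ici_self
    rw [intervalIntegral.integral_ofReal, h1]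
    push_cast
    ring
  memL2 := by simpa using h.memL2
  memL2' := by simpa using h.memL2'
  memL2t := by
    refine Integrable.mono' (h.memL2.add h.memL2t) ?_ (Eventually.of_forall fun t => ?_)
    · refine ContinuousOn.aestronglyMeasurable ?_ measurableSet_Ioi
      have := (Complex.continuous_ofReal.comp_continuousOn h.continuousOn).mono Ioi_subset_Ici_self
      exact (continuousOn_id.pow 2).mul (this.norm.pow 2)
    · rw [Real.norm_of_nonneg (by positivity)]
      simp only [Complex.norm_real, Real.norm_eq_abs, sq_abs, Pi.add_apply]
      nlinarith [mul_nonneg (sq_nonneg (t ^ 2 - 1)) (sq_nonneg (φ t)),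
        mul_nonneg (sq_nonneg t) (sq_nonneg (φ t)), sq_nonneg (t ^ 2 * φ t), sq_nonneg (φ t)]

lemma qform_le (h : IsGroundState γ ξ μ φ φ' φ'') (γ' : ℝ) :
    qform γ' ξ (fun t => (φ t : ℂ)) (fun t => (φ' t : ℂ)) ≤ μ + (γ' - γ) * φ 0 ^ 2 := by
  have hI : IntegrableOn (fun t => φ' t ^ 2 + (t - ξ) ^ 2 * φ t ^ 2) (Ioi 0) := by
    refine h.memL2'.add ?_
    simpa using h.admissibleHL.integrableOn_potential ξ
  have hD := hI.sub (h.memL2.const_mul μ)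
  have hval := integral_sub hI (h.memL2.const_mul μ)
  rw [integral_const_mul, h.normalized] at hval
  have hlim := intervalIntegral_tendsto_integral_Ioi 0 hD tendsto_id
  simp only [Pi.sub_apply] at hlim
  rw [hval] at hlim
  have hle : (∫ t in Ioi (0:ℝ), (φ' t ^ 2 + (t - ξ) ^ 2 * φ t ^ 2)) - μ * 1 ≤ -(γ * φ 0 ^ 2) := by
    refine le_of_tendsto hlim ?_
    filter_upwards [eventually_ge_atTop (|ξ| + |μ| + 1)] with T hT
    have hT0 : 0 ≤ T := le_trans (by positivity) hT
    have hint : ∫ t in (0:ℝ)..T, (φ' t ^ 2 + (t - ξ) ^ 2 * φ t ^ 2 - μ * φ t ^ 2) =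
        φ T * φ' T - φ 0 * φ' 0 := by
      refine intervalIntegral.integral_eq_sub_of_hasDerivAt_of_le (f := fun t => φ t * φ' t) hT0
        ((h.continuousOn.mul h.continuousOn_deriv).mono Icc_subset_Ici_self) (fun t ht => ?_)
        ((intervalIntegrable_iff_integrableOn_Ioc_of_le hT0).2 (hD.mono_set Ioc_subset_Ioi_self))
      have hn := Ici_mem_nhds ht.1
      refine (((h.deriv1 t ht.1.le).hasDerivAt hn).mul
        ((h.deriv2 t ht.1.le).hasDerivAt hn)).congr_deriv ?_
      linear_combination φ t * (-h.eqn t ht.1.le)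
    simp only [id]
    rw [hint, h.bc]
    have h1 := h.deriv_le_neg T hT
    have h2 := h.pos T hT0
    nlinarith
  unfold qform
  simp only [Complex.norm_real, Real.norm_eq_abs, sq_abs]
  linarith

/-- Perturbing the logarithmic derivative of the ground state to first order yields a Riccati
subsolution, hence a lower bound for the form with a quadratic error in `γ' - γ`. -/
lemma exists_mul_integral_le_qform (h : IsGroundState γ ξ μ φ φ' φ'') :
    ∃ M : ℝ, ∀ γ' : ℝ, ∀ u u' : ℝ → ℂ, AdmissibleHL u u' →
      (μ + (γ' - γ) * φ 0 ^ 2 - M * (γ' - γ) ^ 2) * ∫ t in Ioi (0:ℝ), ‖u t‖ ^ 2 ≤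
        qform γ' ξ u u' := by
  obtain ⟨F, M, hF0, hFnn, hFd, hFM⟩ := h.exists_tail
  set a := φ 0 ^ 2 with ha
  have ha0 : 0 < a := pow_pos (h.pos 0 self_mem_Ici) 2
  have hFc : ContinuousOn F (Ici 0) := fun t ht => (hFd t ht).continuousWithinAt
  have hne : ∀ t ∈ Ici (0:ℝ), φ t ≠ 0 := fun t ht => (h.pos t ht).ne'
  have hne2 : ∀ t ∈ Ici (0:ℝ), φ t ^ 2 ≠ 0 := fun t ht => pow_ne_zero 2 (hne t ht)
  have hw : ∀ t ∈ Ici (0:ℝ), 0 ≤ a * (F t / φ t ^ 2) ∧ a * (F t / φ t ^ 2) ≤ a * M := fun t ht => by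
    have hp := pow_pos (h.pos t ht) 2
    have h1 := hFnn t ht
    exact ⟨by positivity, mul_le_mul_of_nonneg_left ((div_le_iff₀ hp).2 (hFM t ht)) ha0.le⟩
  refine ⟨(a * M) ^ 2, fun γ' u u' hu => ?_⟩
  set ε := γ' - γ with hε
  have hr : ∀ t ∈ Ici (0:ℝ), -(t + (|ξ| + |μ| + 1)) ≤ φ' t / φ t := fun t ht => by
    rw [le_div_iff₀ (h.pos t ht)]
    linarith [h.neg_mul_le_deriv t ht]
  refine hu.mul_integral_le_qform (C := |ξ| + |μ| + 1 + |ε| * (a * M))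
    (g := fun t => φ' t / φ t + ε * (a * (F t / φ t ^ 2)))
    (g' := fun t => (φ'' t * φ t - φ' t * φ' t) / φ t ^ 2 +
      ε * (a * ((-φ t ^ 2 * φ t ^ 2 - F t * (2 * φ t ^ (2 - 1) * φ' t)) / (φ t ^ 2) ^ 2)))
    (fun t ht => ?_) ?_ (fun t ht => ?_) ?_ (fun t ht => ?_)
  · exact ((h.deriv2 t ht).div (h.deriv1 t ht) (hne t ht)).add
      ((((hFd t ht).div ((h.deriv1 t ht).fun_pow 2) (hne2 t ht)).const_mul a).const_mul ε)
  · have h0 := h.continuousOn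
    have h1 := h.continuousOn_deriv
    have h2 := h.cont2
    refine ContinuousOn.add (ContinuousOn.div (by fun_prop) (by fun_prop) hne2) ?_
    refine continuousOn_const.mul (continuousOn_const.mul (ContinuousOn.div (by fun_prop)
      (by fun_prop) fun t ht => pow_ne_zero 2 (hne2 t ht)))
  · obtain ⟨h1, h2⟩ := hw t ht
    have h3 : ε ^ 2 * (a * (F t / φ t ^ 2)) ^ 2 ≤ ε ^ 2 * (a * M) ^ 2 := by gcongr
    have h4 : φ'' t = ((t - ξ) ^ 2 - μ) * φ t := by linear_combination -h.eqn t ht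
    have h5 : (φ'' t * φ t - φ' t * φ' t) / φ t ^ 2 +
        ε * (a * ((-φ t ^ 2 * φ t ^ 2 - F t * (2 * φ t ^ (2 - 1) * φ' t)) / (φ t ^ 2) ^ 2)) +
        (φ' t / φ t + ε * (a * (F t / φ t ^ 2))) ^ 2 =
        (t - ξ) ^ 2 - μ - ε * a + ε ^ 2 * (a * (F t / φ t ^ 2)) ^ 2 := by
      have := hne t ht
      rw [h4]
      field_simp
      ring
    rw [h5]
    linarith
  · have h1 := hne 0 self_mem_Ici
    rw [h.bc, hF0, ha, hε]
    refine le_of_eq ?_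
    field_simp
    ring
  · obtain ⟨h1, h2⟩ := hw t ht
    have ht0 : 0 ≤ t := ht
    have h3 := hr t ht
    have h4 : -(|ε| * (a * M)) ≤ ε * (a * (F t / φ t ^ 2)) := by
      have h5 := mul_le_mul_of_nonneg_left h2 (abs_nonneg ε)
      have h6 := mul_le_mul_of_nonneg_right (neg_abs_le ε) h1
      linarith
    have h7 : 0 ≤ |ε| * (a * M) * t := mul_nonneg (mul_nonneg (abs_nonneg ε) (h1.trans h2)) ht0
    nlinarith [mul_nonneg (add_nonneg (abs_nonneg ξ) (abs_nonneg μ)) ht0]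

end IsGroundState

/-- For a ground state `φ` of `H[γ,ξ]`, the function `γ' ↦ μ⁽¹⁾(γ',ξ)` is differentiable
at `γ` with derivative `|φ(0)|²`. -/
theorem mu1_deriv_gamma (γ ξ : ℝ) (φ φ' φ'' : ℝ → ℝ)
    (h : IsGroundState γ ξ (mu1 γ ξ) φ φ' φ'') :
    HasDerivAt (fun γ' : ℝ => mu1 γ' ξ) ((φ 0) ^ 2) γ := by
  obtain ⟨M, hM⟩ := h.exists_mul_integral_le_qform
  have hne : ∃ t ∈ Ici (0:ℝ), (φ t : ℂ) ≠ 0 :=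
    ⟨0, self_mem_Ici, by exact_mod_cast (h.pos 0 self_mem_Ici).ne'⟩
  have hlb : ∀ γ' : ℝ, ∀ r ∈ { r : ℝ | ∃ u u' : ℝ → ℂ, AdmissibleHL u u' ∧
      (∃ t ∈ Ici (0:ℝ), u t ≠ 0) ∧ r = qform γ' ξ u u' / ∫ t in Ioi (0:ℝ), ‖u t‖ ^ 2 },
      mu1 γ ξ + (γ' - γ) * φ 0 ^ 2 - M * (γ' - γ) ^ 2 ≤ r := by
    rintro γ' r ⟨u, u', hu, hune, rfl⟩
    rw [le_div_iff₀ (hu.integral_norm_sq_pos hune)]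
    exact hM γ' u u' hu
  have hlower : ∀ γ', mu1 γ ξ + (γ' - γ) * φ 0 ^ 2 - M * (γ' - γ) ^ 2 ≤ mu1 γ' ξ := fun γ' =>
    le_csInf ⟨_, _, _, h.admissibleHL, hne, rfl⟩ (hlb γ')
  have hupper : ∀ γ', mu1 γ' ξ ≤ mu1 γ ξ + (γ' - γ) * φ 0 ^ 2 := fun γ' => by
    refine (csInf_le ⟨_, hlb γ'⟩ ⟨_, _, h.admissibleHL, hne, rfl⟩).trans ?_
    have hn : ∫ t in Ioi (0:ℝ), ‖(φ t : ℂ)‖ ^ 2 = 1 := by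
      simpa using h.normalized
    rw [hn, div_one]
    exact h.qform_le γ'
  rw [hasDerivAt_iff_isLittleO]
  have hO : (fun γ' => mu1 γ' ξ - mu1 γ ξ - (γ' - γ) • φ 0 ^ 2) =O[𝓝 γ]
      fun γ' => (γ' - γ) ^ 2 := by
    refine Asymptotics.IsBigO.of_bound M (Eventually.of_forall fun γ' => ?_)
    rw [Real.norm_eq_abs, Real.norm_of_nonneg (sq_nonneg _), smul_eq_mul, abs_le]
    constructor <;> linarith [hlower γ', hupper γ']
  exact hO.trans_isLittleO (by
    simpa using (Asymptotics.isLittleO_pow_sub_sub γ one_lt_two))
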